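/- arXiv:2501.04725 — 6 statements merged into one kernel-verified Lean document; each statement's English description precedes it below -/
import Mathlib

section
/- Let V be a 6-dimensional vector space over GF(2) equipped with a nondegenerate alternating bilinear form B. Then the number of 3-dimensional totally isotropic subspaces of V (totally isotropic planes) is exactly 135. -/
/-- Linearly independent `k`-tuples of pairwise orthogonal vectors. -/
abbrev IsoFrame {V : Type*} [AddCommGroup V] [Module (ZMod 2) V]
    (B : V →ₗ[ZMod 2] V →ₗ[ZMod 2] ZMod 2) (k : ℕ) : Type _ :=
  {s : Fin k → V // LinearIndependent (ZMod 2) s ∧ ∀ i j, B (s i) (s j) = 0}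

section helpers

variable {V : Type*} [AddCommGroup V] [Module (ZMod 2) V]
  (B : V →ₗ[ZMod 2] V →ₗ[ZMod 2] ZMod 2)

theorem span_iso {k : ℕ} (s : Fin k → V) (h : ∀ i j, B (s i) (s j) = 0) :
    ∀ x ∈ Submodule.span (ZMod 2) (Set.range s),
      ∀ y ∈ Submodule.span (ZMod 2) (Set.range s), B x y = 0 := by
  intro x hx y hy
  induction hx, hy using Submodule.span_induction₂ with
  | mem_mem x y hx hy =>
    obtain ⟨i, rfl⟩ := hx
    obtain ⟨j, rfl⟩ := hy
    exact h i j
  | zero_left => simp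
  | zero_right => simp
  | add_left x y z _ _ _ h1 h2 => simp [h1, h2]
  | add_right x y z _ _ _ h1 h2 => simp [h1, h2]
  | smul_left r x y _ _ h1 => simp [h1]
  | smul_right r x y _ _ h1 => simp [h1]

theorem mem_orth_span {k : ℕ} (s : Fin k → V) (v : V) :
    v ∈ LinearMap.BilinForm.orthogonal B (Submodule.span (ZMod 2) (Set.range s)) ↔
      ∀ i, B (s i) v = 0 := by
  rw [LinearMap.BilinForm.mem_orthogonal_iff]
  constructor
  · intro h i
    exact h _ (Submodule.subset_span ⟨i, rfl⟩)
  · intro h x hx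
    induction hx using Submodule.span_induction with
    | mem x hx =>
      obtain ⟨i, rfl⟩ := hx
      exact h i
    | zero => simp
    | add x y _ _ h1 h2 => simp [h1, h2]
    | smul r x _ h1 => simp [h1]

/-- Splitting off the first vector of a frame. -/
def frameEquiv (halt : ∀ x : V, B x x = 0) (hsymm : ∀ x y : V, B x y = 0 → B y x = 0) (k : ℕ) :
    IsoFrame B (k + 1) ≃ Σ s : IsoFrame B k,
      ((LinearMap.BilinForm.orthogonal B (Submodule.span (ZMod 2) (Set.range s.1)) : Set V) \
        (Submodule.span (ZMod 2) (Set.range s.1) : Set V) : Set V) where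
  toFun s := ⟨⟨Fin.tail s.1, (linearIndependent_finSucc.mp s.2.1).1,
      fun i j => s.2.2 i.succ j.succ⟩,
    ⟨s.1 0, (mem_orth_span B _ _).2 fun i => s.2.2 i.succ 0,
      (linearIndependent_finSucc.mp s.2.1).2⟩⟩
  invFun s := ⟨Fin.cons s.2.1 s.1.1, linearIndependent_finCons.mpr ⟨s.1.2.1, s.2.2.2⟩, by
    have h := (mem_orth_span B _ _).1 s.2.2.1
    intro i j
    refine Fin.cases ?_ (fun i => ?_) i <;> refine Fin.cases ?_ (fun j => ?_) j
    · simpa using halt _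
    · simpa using hsymm _ _ (h j)
    · simpa using h i
    · simpa using s.1.2.2 i j⟩
  left_inv s := by
    apply Subtype.ext
    exact Fin.cons_self_tail s.1
  right_inv s := rfl

theorem card_sub [FiniteDimensional (ZMod 2) V] (W : Submodule (ZMod 2) V) :
    (W : Set V).ncard = 2 ^ Module.finrank (ZMod 2) W := by
  have := Module.natCard_eq_pow_finrank (K := ZMod 2) (V := W)
  rw [Nat.card_zmod] at this
  rw [← this]
  rfl

theorem card_frame_succ [FiniteDimensional (ZMod 2) V]
    (halt : ∀ x : V, B x x = 0)
    (hnd : ∀ x : V, (∀ y : V, B x y = 0) → x = 0) (k : ℕ) :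
    Nat.card (IsoFrame B (k + 1)) =
      Nat.card (IsoFrame B k) * (2 ^ (Module.finrank (ZMod 2) V - k) - 2 ^ k) := by
  have hfin : Finite V := Module.finite_of_finite (ZMod 2)
  have hrefl : LinearMap.IsRefl B := (show LinearMap.IsAlt B from halt).isRefl
  have hB : LinearMap.BilinForm.Nondegenerate B :=
    hrefl.nondegenerate_iff_separatingLeft.2 hnd
  have := Fintype.ofFinite (IsoFrame B k)
  rw [Nat.card_congr (frameEquiv B halt hrefl k), Nat.card_sigma]
  have key : ∀ s : IsoFrame B k, Nat.card
      ((LinearMap.BilinForm.orthogonal B (Submodule.span (ZMod 2) (Set.range s.1)) : Set V) \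
        (Submodule.span (ZMod 2) (Set.range s.1) : Set V) : Set V)
      = 2 ^ (Module.finrank (ZMod 2) V - k) - 2 ^ k := by
    intro s
    have hle : (Submodule.span (ZMod 2) (Set.range s.1) : Set V) ⊆
        LinearMap.BilinForm.orthogonal B (Submodule.span (ZMod 2) (Set.range s.1)) :=
      fun x hx y hy => span_iso B s.1 s.2.2 y hy x hx
    rw [Nat.card_coe_set_eq, Set.ncard_diff hle, card_sub, card_sub,
      LinearMap.BilinForm.finrank_orthogonal hB, finrank_span_eq_card s.2.1, Fintype.card_fin]
  rw [Finset.sum_congr rfl fun s _ => key s]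
  simp

theorem card_frame_zero : Nat.card (IsoFrame B 0) = 1 := by
  have : Unique (IsoFrame B 0) :=
    { default := ⟨Fin.elim0, linearIndependent_empty_type, fun i => i.elim0⟩
      uniq := fun s => Subtype.ext (Subsingleton.elim _ _) }
  exact Nat.card_unique

/-- Isotropic 3-frames correspond to isotropic planes with an ordered basis. -/
noncomputable def framePlaneEquiv :
    IsoFrame B 3 ≃ Σ W : {W : Submodule (ZMod 2) V //
      Module.finrank (ZMod 2) W = 3 ∧ ∀ x ∈ W, ∀ y ∈ W, B x y = 0},
      {s : Fin 3 → W.1 // LinearIndependent (ZMod 2) s} := by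
  refine Equiv.symm (Equiv.ofBijective
    (fun p => ⟨fun i => (p.2.1 i : V), p.2.2.map' p.1.1.subtype (Submodule.ker_subtype _),
      fun i j => p.1.2.2 _ (p.2.1 i).2 _ (p.2.1 j).2⟩) ⟨?_, ?_⟩)
  · have hspan : ∀ (W : {W : Submodule (ZMod 2) V //
        Module.finrank (ZMod 2) W = 3 ∧ ∀ x ∈ W, ∀ y ∈ W, B x y = 0})
        (s : Fin 3 → W.1), LinearIndependent (ZMod 2) s →
        Submodule.span (ZMod 2) (Set.range fun i => (s i : V)) = W.1 := by
      intro W s hs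
      have h1 := hs.span_eq_top_of_card_eq_finrank (by rw [W.2.1]; simp)
      have h2 := congrArg (Submodule.map W.1.subtype) h1
      rw [Submodule.map_span, Submodule.map_top, Submodule.range_subtype, ← Set.range_comp] at h2
      exact h2
    rintro ⟨W, s, hs⟩ ⟨W', s', hs'⟩ h
    have h' : (fun i => (s i : V)) = fun i => (s' i : V) := congrArg Subtype.val h
    have hW : W = W' := by
      apply Subtype.ext
      rw [← hspan W s hs, ← hspan W' s' hs', h']
    subst hW
    have : s = s' := by
      funext i
      exact Subtype.ext (congrFun h' i)
    subst this
    rfl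
  · rintro ⟨s, hs, h⟩
    exact ⟨⟨⟨Submodule.span (ZMod 2) (Set.range s),
      by rw [finrank_span_eq_card hs, Fintype.card_fin], span_iso B s h⟩,
      ⟨fun i => ⟨s i, Submodule.subset_span ⟨i, rfl⟩⟩, linearIndependent_span hs⟩⟩, rfl⟩

end helpers


/-- A 6-dimensional vector space over `GF(2)` with a nondegenerate alternating bilinear
form contains exactly `135` totally isotropic planes (3-dimensional totally isotropic
subspaces). -/
theorem num_totally_isotropic_planes
    (V : Type*) [AddCommGroup V] [Module (ZMod 2) V] [FiniteDimensional (ZMod 2) V]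
    (hV : Module.finrank (ZMod 2) V = 6)
    (B : V →ₗ[ZMod 2] V →ₗ[ZMod 2] ZMod 2)
    (halt : ∀ x : V, B x x = 0)
    (hnd : ∀ x : V, (∀ y : V, B x y = 0) → x = 0) :
    Nat.card {W : Submodule (ZMod 2) V //
      Module.finrank (ZMod 2) W = 3 ∧ ∀ x ∈ W, ∀ y ∈ W, B x y = 0} = 135 := by

  have hfin : Finite V := Module.finite_of_finite (ZMod 2)
  have h3 : Nat.card (IsoFrame B 3) = 22680 := by
    rw [card_frame_succ B halt hnd, card_frame_succ B halt hnd, card_frame_succ B halt hnd,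
      card_frame_zero, hV]
    norm_num
  have : Finite (Submodule (ZMod 2) V) :=
    Finite.of_injective (fun W => (W : Set V)) SetLike.coe_injective
  have := Fintype.ofFinite {W : Submodule (ZMod 2) V //
      Module.finrank (ZMod 2) W = 3 ∧ ∀ x ∈ W, ∀ y ∈ W, B x y = 0}
  rw [Nat.card_congr (framePlaneEquiv B), Nat.card_sigma] at h3
  have key : ∀ W : {W : Submodule (ZMod 2) V //
      Module.finrank (ZMod 2) W = 3 ∧ ∀ x ∈ W, ∀ y ∈ W, B x y = 0},
      Nat.card {s : Fin 3 → W.1 // LinearIndependent (ZMod 2) s} = 168 := by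
    intro W
    rw [card_linearIndependent W.2.1.ge, W.2.1, ZMod.card]
    simp [Fin.prod_univ_succ]
  rw [Finset.sum_congr rfl fun W _ => key W, Finset.sum_const, Finset.card_univ,
    ← Nat.card_eq_fintype_card, smul_eq_mul] at h3
  omega
end

section
/- Let V be a 6-dimensional vector space over GF(2) equipped with a nondegenerate alternating bilinear form B. Then every 2-dimensional totally isotropic subspace of V is contained in exactly 3 of the 3-dimensional totally isotropic subspaces of V. -/
lemma aux_finrank_map {V : Type*} [AddCommGroup V] [Module (ZMod 2) V]
    [FiniteDimensional (ZMod 2) V] (W M : Submodule (ZMod 2) V) (h : W ≤ M) :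
    Module.finrank (ZMod 2) (M.map W.mkQ) + Module.finrank (ZMod 2) W
      = Module.finrank (ZMod 2) M := by
  have h1 := LinearMap.finrank_range_add_finrank_ker (W.mkQ.domRestrict M)
  rw [LinearMap.range_domRestrict, LinearMap.ker_domRestrict, Submodule.ker_mkQ] at h1
  rw [← h1, (Submodule.comapSubtypeEquivOfLe h).finrank_eq]

/-- In a 6-dimensional vector space over `GF(2)` with a nondegenerate alternating
bilinear form, every totally isotropic line (2-dimensional totally isotropic subspace)
is contained in exactly `3` totally isotropic planes (3-dimensional totally isotropic
subspaces). -/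
theorem totally_isotropic_line_in_three_planes
    (V : Type*) [AddCommGroup V] [Module (ZMod 2) V] [FiniteDimensional (ZMod 2) V]
    (hV : Module.finrank (ZMod 2) V = 6)
    (B : V →ₗ[ZMod 2] V →ₗ[ZMod 2] ZMod 2)
    (halt : ∀ x : V, B x x = 0)
    (hnd : ∀ x : V, (∀ y : V, B x y = 0) → x = 0)
    (W : Submodule (ZMod 2) V)
    (hW2 : Module.finrank (ZMod 2) W = 2)
    (hWiso : ∀ x ∈ W, ∀ y ∈ W, B x y = 0) :
    Nat.card {M : Submodule (ZMod 2) V //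
      Module.finrank (ZMod 2) M = 3 ∧ (∀ x ∈ M, ∀ y ∈ M, B x y = 0) ∧ W ≤ M} = 3 := by
  have hAlt : LinearMap.BilinForm.IsAlt B := halt
  have hrefl : LinearMap.BilinForm.IsRefl B := hAlt.isRefl
  have hN : LinearMap.BilinForm.Nondegenerate B :=
    ⟨fun x hx => hnd x hx, fun x hx => hnd x fun y => hrefl _ _ (hx y)⟩
  have hP := LinearMap.BilinForm.finrank_orthogonal hN W
  set P := LinearMap.BilinForm.orthogonal B W with hPdef
  have memP : ∀ x, x ∈ P ↔ ∀ w ∈ W, B w x = 0 := fun x => Iff.rfl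
  have hWP : W ≤ P := fun x hx => (memP x).2 fun w hw => hWiso w hw x hx
  have hQ := aux_finrank_map W P hWP
  have hQ2 : Module.finrank (ZMod 2) (P.map W.mkQ) = 2 := by omega
  have hcardQ : Nat.card (P.map W.mkQ) = 4 := by
    rw [Module.natCard_eq_pow_finrank (K := ZMod 2), hQ2]; simp
  have : Finite (P.map W.mkQ) := Nat.finite_of_card_ne_zero (by omega)
  have hcard : Nat.card {q : P.map W.mkQ // q ≠ 0} = 3 := by
    classical
    have := Fintype.ofFinite (P.map W.mkQ)
    rw [Nat.card_eq_fintype_card] at hcardQ ⊢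
    rw [Fintype.card_subtype_compl, hcardQ]; simp
  have z2 : ∀ c : ZMod 2, c = 0 ∨ c = 1 := by decide
  rw [← hcard]
  symm
  have hle : ∀ N : Submodule (ZMod 2) (V ⧸ W), W ≤ N.comap W.mkQ := fun N =>
    Submodule.le_comap_mkQ W N
  have hsurj : Function.Surjective W.mkQ := Submodule.mkQ_surjective W
  refine Nat.card_congr (Equiv.ofBijective
    (fun q => ⟨(Submodule.span (ZMod 2) {(q.1 : V ⧸ W)}).comap W.mkQ, ?_, ?_, hle _⟩) ⟨?_, ?_⟩)
  · have h := aux_finrank_map W _ (hle (Submodule.span (ZMod 2) {(q.1 : V ⧸ W)}))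
    rw [Submodule.map_comap_eq_of_surjective hsurj,
      finrank_span_singleton (fun h0 => q.2 (Subtype.ext h0))] at h
    omega
  · obtain ⟨⟨q, x, hx, rfl⟩, hq⟩ := q
    have key : ∀ y ∈ (Submodule.span (ZMod 2) {W.mkQ x}).comap W.mkQ,
        ∃ c : ZMod 2, ∃ w ∈ W, y = c • x + w := by
      intro y hy
      obtain ⟨c, hc⟩ := Submodule.mem_span_singleton.1 (Submodule.mem_comap.1 hy)
      refine ⟨c, y - c • x, ?_, by abel⟩
      rw [← Submodule.ker_mkQ W, LinearMap.mem_ker, map_sub, map_smul, hc, sub_self]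
    intro y hy z hz
    obtain ⟨c, w, hw, rfl⟩ := key y hy
    obtain ⟨d, w', hw', rfl⟩ := key z hz
    have e1 := (memP x).1 hx w hw
    have e2 := hrefl _ _ ((memP x).1 hx w' hw')
    simp [halt, e1, e2, hWiso w hw w' hw']
  · rintro ⟨⟨q, hq⟩, hq0⟩ ⟨⟨r, hr⟩, hr0⟩ h
    have h1 := Submodule.comap_injective_of_surjective hsurj (congrArg Subtype.val h)
    have h2 : q ∈ Submodule.span (ZMod 2) {r} := h1 ▸ Submodule.mem_span_singleton_self q
    obtain ⟨c, hc⟩ := Submodule.mem_span_singleton.1 h2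
    rcases z2 c with rfl | rfl
    · exact absurd (Subtype.ext (by simpa using hc.symm)) hq0
    · simp only [one_smul] at hc
      subst hc; rfl
  · rintro ⟨M, hM3, hMiso, hWM⟩
    have h := aux_finrank_map W M hWM
    have h1 : Module.finrank (ZMod 2) (M.map W.mkQ) = 1 := by omega
    obtain ⟨⟨q, hq⟩, hq0, hqs⟩ := finrank_eq_one_iff'.1 h1
    have hMP : M ≤ P := fun x hx => (memP x).2 fun w hw => hMiso w (hWM hw) x hx
    refine ⟨⟨⟨q, Submodule.map_mono hMP hq⟩, fun h0 => ?_⟩, ?_⟩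
    · have h00 : q = 0 := congrArg Subtype.val h0
      exact hq0 (Subtype.ext h00)
    apply Subtype.ext
    have hs : Submodule.span (ZMod 2) {q} = M.map W.mkQ := by
      apply le_antisymm
      · rw [Submodule.span_singleton_le_iff_mem]; exact hq
      · intro y hy
        obtain ⟨c, hc⟩ := hqs ⟨y, hy⟩
        exact Submodule.mem_span_singleton.2 ⟨c, congrArg Subtype.val hc⟩
    change (Submodule.span (ZMod 2) {q}).comap W.mkQ = M
    rw [hs, Submodule.comap_map_mkQ, sup_eq_right.2 hWM]
end

section
/- Let F be the field with four elements and let h be the standard hermitian form on F³ given by h(x,y) = x₀y₀² + x₁y₁² + x₂y₂². Let u ∈ F³ with h(u,u) = 1. Then the number of nonzero vectors x ∈ F³ with h(x,x) = 0 and h(u,x) = 0 is exactly 9. -/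
/-- The standard hermitian form `h(x,y) = x₀·y₀² + x₁·y₁² + x₂·y₂²` on `F³`, where `F` is
the field with four elements (conjugation being the Frobenius `y ↦ y²`). -/
noncomputable def herm (x y : Fin 3 → GaloisField 2 2) : GaloisField 2 2 :=
  ∑ i : Fin 3, x i * (y i) ^ 2

/-- Concrete model of the four element field: `(a, b)` stands for `a + b ω`. -/
abbrev B4 := Bool × Bool

def B4.add' (x y : B4) : B4 := (xor x.1 y.1, xor x.2 y.2)

def B4.mul' (x y : B4) : B4 :=
  (xor (x.1 && y.1) (x.2 && y.2),
    xor (xor (x.1 && y.2) (x.2 && y.1)) (x.2 && y.2))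

def B4.tm (x y : B4) : B4 := B4.mul' x (B4.mul' y y)

def B4.herm' (x y : Fin 3 → B4) : B4 :=
  B4.add' (B4.add' (B4.tm (x 0) (y 0)) (B4.tm (x 1) (y 1))) (B4.tm (x 2) (y 2))

set_option maxRecDepth 100000 in
theorem B4.count : ∀ u : Fin 3 → B4, B4.herm' u u = (true, false) →
    Fintype.card {x : Fin 3 → B4 // x ≠ (fun _ => (false, false)) ∧
      B4.herm' x x = (false, false) ∧ B4.herm' u x = (false, false)} = 9 := by
  decide +kernel

theorem card_gf4 : Nat.card (GaloisField 2 2) = 4 := by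
  rw [GaloisField.card 2 2 (by norm_num)]; norm_num

theorem exists_omega : ∃ w : GaloisField 2 2, w ^ 2 = w + 1 ∧ w ≠ 0 ∧ w ≠ 1 := by
  classical
  have : Fintype (GaloisField 2 2) := Fintype.ofFinite _
  have hc : Fintype.card (GaloisField 2 2) = 4 := by
    rw [← Nat.card_eq_fintype_card, card_gf4]
  have h2 : (2 : GaloisField 2 2) = 0 := CharTwo.two_eq_zero
  obtain ⟨w, hw⟩ : ∃ w, w ∉ ({0, 1} : Finset (GaloisField 2 2)) := by
    by_contra! h
    have h1 := Finset.card_le_card (s := Finset.univ) (t := {0, 1}) (fun x _ => h x)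
    have h3 := Finset.card_le_two (a := (0 : GaloisField 2 2)) (b := 1)
    rw [Finset.card_univ, hc] at h1
    omega
  simp only [Finset.mem_insert, Finset.mem_singleton, not_or] at hw
  refine ⟨w, ?_, hw.1, hw.2⟩
  have h4 : w ^ 4 = w := by rw [← hc]; exact FiniteField.pow_card w
  have h5 : (w * (w - 1)) * (w ^ 2 - (w + 1)) = 0 := by
    linear_combination h4 + (w - w ^ 3) * h2
  have h6 : w * (w - 1) ≠ 0 := mul_ne_zero hw.1 (sub_ne_zero.mpr hw.2)
  exact sub_eq_zero.mp ((mul_eq_zero.mp h5).resolve_left h6)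

noncomputable def B4.toGF (w : GaloisField 2 2) (x : B4) : GaloisField 2 2 :=
  (if x.1 then 1 else 0) + (if x.2 then w else 0)

theorem B4.toGF_add (w : GaloisField 2 2) (x y : B4) :
    B4.toGF w (B4.add' x y) = B4.toGF w x + B4.toGF w y := by
  have h2 : (2 : GaloisField 2 2) = 0 := CharTwo.two_eq_zero
  obtain ⟨a, b⟩ := x
  obtain ⟨c, d⟩ := y
  cases a <;> cases b <;> cases c <;> cases d <;> simp [B4.toGF, B4.add'] <;> grind

theorem B4.toGF_mul (w : GaloisField 2 2) (hw : w ^ 2 = w + 1) (x y : B4) :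
    B4.toGF w (B4.mul' x y) = B4.toGF w x * B4.toGF w y := by
  have h2 : (2 : GaloisField 2 2) = 0 := CharTwo.two_eq_zero
  obtain ⟨a, b⟩ := x
  obtain ⟨c, d⟩ := y
  cases a <;> cases b <;> cases c <;> cases d <;> simp [B4.toGF, B4.mul'] <;> grind

theorem B4.toGF_bij (w : GaloisField 2 2) (h0 : w ≠ 0) (h1 : w ≠ 1) :
    Function.Bijective (B4.toGF w) := by
  have h2 : (2 : GaloisField 2 2) = 0 := CharTwo.two_eq_zero
  have : Fintype (GaloisField 2 2) := Fintype.ofFinite _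
  rw [Fintype.bijective_iff_injective_and_card]
  constructor
  · rintro ⟨a, b⟩ ⟨c, d⟩ h
    have h3 : (1 : GaloisField 2 2) ≠ 0 := one_ne_zero
    cases a <;> cases b <;> cases c <;> cases d <;> simp [B4.toGF] at h ⊢ <;> grind
  · rw [← Nat.card_eq_fintype_card (α := GaloisField 2 2), card_gf4]; rfl

theorem B4.toGF_herm (w : GaloisField 2 2) (hw : w ^ 2 = w + 1) (x y : Fin 3 → B4) :
    herm (fun i => B4.toGF w (x i)) (fun i => B4.toGF w (y i)) =
      B4.toGF w (B4.herm' x y) := by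
  simp only [herm, Fin.sum_univ_three, B4.herm', B4.tm, B4.toGF_add, B4.toGF_mul w hw, sq]

/-- For a vector `u` of `GF(4)³` with `h(u,u) = 1`, there are exactly `9` nonzero
isotropic vectors orthogonal to `u`. -/
theorem num_isotropic_in_polar_line
    (u : Fin 3 → GaloisField 2 2) (hu : herm u u = 1) :
    Nat.card {x : Fin 3 → GaloisField 2 2 //
      x ≠ 0 ∧ herm x x = 0 ∧ herm u x = 0} = 9 := by
  obtain ⟨w, hw, h0, h1⟩ := exists_omega
  have hb := B4.toGF_bij w h0 h1
  let e : B4 ≃ GaloisField 2 2 := Equiv.ofBijective _ hb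
  let E : (Fin 3 → B4) ≃ (Fin 3 → GaloisField 2 2) := Equiv.arrowCongr (Equiv.refl _) e
  have hE : ∀ x, E x = fun i => B4.toGF w (x i) := fun x => rfl
  have hz : B4.toGF w (false, false) = 0 := by simp [B4.toGF]
  have ho : B4.toGF w (true, false) = 1 := by simp [B4.toGF]
  have hz' : ∀ a, B4.toGF w a = 0 ↔ a = (false, false) := fun a => by
    rw [← hz]; exact hb.1.eq_iff
  obtain ⟨v, rfl⟩ := E.surjective u
  rw [hE, B4.toGF_herm w hw, ← ho] at hu
  rw [← B4.count v (hb.1 hu), ← Nat.card_eq_fintype_card]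
  refine (Nat.card_congr (E.subtypeEquiv fun x => ?_)).symm
  rw [hE, hE, B4.toGF_herm w hw, B4.toGF_herm w hw, hz', hz']
  refine and_congr (not_congr ?_) Iff.rfl
  simp only [funext_iff, Pi.zero_apply, hz']
end

section
/- Let F be the field with four elements and let h be the standard hermitian form on F³ given by h(x,y) = x₀y₀² + x₁y₁² + x₂y₂². Let a, b ∈ F³ be nonzero vectors with h(a,a) = 0, h(b,b) = 0 and h(a,b) = 0. Then b is a scalar multiple of a, i.e. there exists α ∈ F with b = α • a. -/
/-- Cubes in the field with four elements. -/
theorem gf4_cube (x : GaloisField 2 2) : x = 0 ∨ x ^ 3 = 1 := by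
  haveI : Fintype (GaloisField 2 2) := Fintype.ofFinite _
  have hc : Fintype.card (GaloisField 2 2) = 4 := by
    rw [← Nat.card_eq_fintype_card, GaloisField.card 2 2 (by norm_num)]; norm_num
  by_cases hx : x = 0
  · exact Or.inl hx
  · right
    have := FiniteField.pow_card_sub_one_eq_one x hx
    rwa [hc] at this

/-- The key computation when the last coordinate of `a` vanishes. -/
theorem gf4_key (a b c x y z : GaloisField 2 2) (ha : a ≠ 0) (hb : b ≠ 0) (hc : c = 0)
    (hxyz : x * x ^ 2 + y * y ^ 2 + z * z ^ 2 = 0)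
    (hab : a * x ^ 2 + b * y ^ 2 + c * z ^ 2 = 0) :
    z = 0 ∧ a * y = b * x := by
  have h2 : (2 : GaloisField 2 2) = 0 := CharTwo.two_eq_zero
  subst hc
  rcases gf4_cube x with hx | hx
  · subst hx
    have hy : y = 0 := by simpa [hb] using hab
    subst hy
    exact ⟨by simpa using hxyz, by ring⟩
  · rcases gf4_cube y with hy | hy
    · subst hy
      have hx0 : x = 0 := by simpa [ha] using hab
      subst hx0
      simp at hx
    · refine ⟨?_, ?_⟩
      · have : z ^ 3 = 0 := by linear_combination hxyz - hx - hy - h2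
        exact pow_eq_zero_iff (by norm_num) |>.1 this
      · linear_combination (x * y) * hab - a * y * hx - b * x * hy - b * x * h2

/-- Two orthogonal nonzero isotropic vectors of `GF(4)³` are proportional. -/
theorem orthogonal_isotropic_proportional
    (a b : Fin 3 → GaloisField 2 2) (ha0 : a ≠ 0) (hb0 : b ≠ 0)
    (ha : herm a a = 0) (hb : herm b b = 0) (hab : herm a b = 0) :
    ∃ α : GaloisField 2 2, b = α • a := by
  have h2 : (2 : GaloisField 2 2) = 0 := CharTwo.two_eq_zero
  simp only [herm, Fin.sum_univ_three] at ha hb hab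
  have fin : ∀ i j k : Fin 3, (∀ l, l = i ∨ l = j ∨ l = k) → a i ≠ 0 → a j ≠ 0 → a k = 0 →
      b i * b i ^ 2 + b j * b j ^ 2 + b k * b k ^ 2 = 0 →
      a i * b i ^ 2 + a j * b j ^ 2 + a k * b k ^ 2 = 0 →
      ∃ α : GaloisField 2 2, b = α • a := by
    intro i j k hl hi hj hk h1 h3
    obtain ⟨hz, he⟩ := gf4_key _ _ _ _ _ _ hi hj hk h1 h3
    refine ⟨b i / a i, ?_⟩
    funext l
    simp only [Pi.smul_apply, smul_eq_mul]
    rcases hl l with rfl | rfl | rfl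
    · field_simp
    · field_simp
      linear_combination he
    · rw [hz, hk, mul_zero]
  have ne : ∀ x : GaloisField 2 2, x ^ 3 = 1 → x ≠ 0 := by
    rintro x hx rfl
    simp at hx
  rcases gf4_cube (a 0) with h0 | h0 <;> rcases gf4_cube (a 1) with h1 | h1 <;>
    rcases gf4_cube (a 2) with h3 | h3
  · exact absurd (by funext l; fin_cases l <;> simp [h0, h1, h3]) ha0
  · simp [h0, h1, ne _ h3] at ha
  · simp [h0, h3, ne _ h1] at ha
  · exact fin 1 2 0 (by decide) (ne _ h1) (ne _ h3) h0 (by linear_combination hb)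
      (by linear_combination hab)
  · simp [h1, h3, ne _ h0] at ha
  · exact fin 0 2 1 (by decide) (ne _ h0) (ne _ h3) h1 (by linear_combination hb)
      (by linear_combination hab)
  · exact fin 0 1 2 (by decide) (ne _ h0) (ne _ h1) h3 hb hab
  · exact absurd (by linear_combination ha - h0 - h1 - h3 - h2) (one_ne_zero (α := GaloisField 2 2))
end

section
/- Let F be the field with four elements and let h be the standard hermitian form on F³ given by h(x,y) = x₀y₀² + x₁y₁² + x₂y₂². Let a, b, u ∈ F³ with h(a,a) = 0, h(b,b) = 0, h(a,b) = 1, h(u,a) = 0, h(u,b) = 0 and h(u,u) = 1. Then for every nonzero scalar α ∈ F, one has h(α•u + a, α•u + b) = 0, h(α•u + a, α•u + a) = 1 and h(α•u + b, α•u + b) = 1. -/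
theorem gf4_pow_four (x : GaloisField 2 2) : x ^ 4 = x := by
  have : Fintype (GaloisField 2 2) := Fintype.ofFinite _
  have hc : Fintype.card (GaloisField 2 2) = 4 := by
    rw [← Nat.card_eq_fintype_card, GaloisField.card 2 2 (by norm_num)]
    norm_num
  have h := FiniteField.pow_card x
  rwa [hc] at h

theorem herm_symm (x y : Fin 3 → GaloisField 2 2) : herm y x = herm x y ^ 2 := by
  unfold herm
  rw [sum_pow_char 2]
  refine Finset.sum_congr rfl fun i _ => ?_
  rw [mul_pow, ← pow_mul, gf4_pow_four, mul_comm]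

theorem herm_expand (α : GaloisField 2 2) (u x y : Fin 3 → GaloisField 2 2) :
    herm (α • u + x) (α • u + y)
      = α ^ 3 * herm u u + α * herm u y + α ^ 2 * herm x u + herm x y := by
  unfold herm
  simp only [Finset.mul_sum, ← Finset.sum_add_distrib]
  refine Finset.sum_congr rfl fun i _ => ?_
  simp only [Pi.add_apply, Pi.smul_apply, smul_eq_mul]
  rw [add_pow_char (p := 2)]
  ring

/-- Translating a hyperbolic pair `a, b` of isotropic vectors of `GF(4)³` by a nonzero
multiple of the radical vector `u` of `⟨a,b⟩⊥` produces two orthogonal non-isotropic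
vectors. -/
theorem translate_hyperbolic_pair
    (a b u : Fin 3 → GaloisField 2 2)
    (ha : herm a a = 0) (hb : herm b b = 0) (hab : herm a b = 1)
    (hua : herm u a = 0) (hub : herm u b = 0) (huu : herm u u = 1) :
    ∀ α : GaloisField 2 2, α ≠ 0 →
      herm (α • u + a) (α • u + b) = 0 ∧
      herm (α • u + a) (α • u + a) = 1 ∧
      herm (α • u + b) (α • u + b) = 1 := by
  intro α hα
  have h3 : α ^ 3 = 1 := by
    apply mul_left_cancel₀ hα
    rw [mul_one, ← pow_succ', gf4_pow_four]
  have hau : herm a u = 0 := by rw [herm_symm u a, hua]; norm_num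
  have hbu : herm b u = 0 := by rw [herm_symm u b, hub]; norm_num
  have h2 : (1 : GaloisField 2 2) + 1 = 0 := CharTwo.add_self_eq_zero 1
  refine ⟨?_, ?_, ?_⟩ <;> rw [herm_expand] <;>
    simp [ha, hb, hab, hua, hub, huu, hau, hbu, h3, h2]
end

section
/- There exists a generalized hexagon of order (2,2): there exist a finite type P with exactly 63 elements and a set L of 3-element subsets of P with exactly 63 members, such that every point of P lies in exactly 3 members of L, any two distinct points of P lie in at most one common member of L, and the bipartite incidence graph on P ⊕ L (where a point p is adjacent to a line l if and only if p ∈ l) is connected with diameter 6 and girth 12. -/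
/-!
The incidence graph of the split Cayley hexagon of order 2 is the Tutte 12-cage, which is
described by the LCF code
`[17,27,-13,-59,-35,35,-11,13,-53,53,-27,21,57,11,-21,-57,59,-17]^7` on `126` vertices.
Even vertices are the points, odd vertices are the lines.
-/

namespace Hexagon

/-- Distance certificate: a function `f` that behaves like the distance function of the
incidence graph of a generalized hexagon. -/
structure Cert {V : Type} (G : SimpleGraph V) (f : V → V → ℕ) : Prop where
  self : ∀ u, f u u = 0
  eq_of_zero : ∀ u v, f u v = 0 → u = v
  le_six : ∀ u v, f u v ≤ 6
  adj : ∀ u a b, G.Adj a b → f u b = f u a + 1 ∨ f u a = f u b + 1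
  down : ∀ u a, f u a ≠ 0 → ∃ b, G.Adj a b ∧ f u b + 1 = f u a
  uniq : ∀ u a b c, f u a ≤ 5 → G.Adj a b → G.Adj a c → f u b < f u a → f u c < f u a → b = c
  six : ∃ u v, f u v = 6

theorem Cert.comap {V W : Type} {G : SimpleGraph V} {H : SimpleGraph W} {f : W → W → ℕ}
    (h : Cert H f) (e : G ≃g H) : Cert G (fun a b => f (e a) (e b)) where
  self u := h.self _
  eq_of_zero u v hz := e.injective (h.eq_of_zero _ _ hz)
  le_six u v := h.le_six _ _
  adj u a b hab := h.adj _ _ _ (e.map_adj_iff.2 hab)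
  down u a ha := by
    obtain ⟨b, hb, hf⟩ := h.down (e u) (e a) ha
    refine ⟨e.symm b, ?_, by simpa using hf⟩
    rw [← e.map_adj_iff]
    simpa using hb
  uniq u a b c h5 hab hac hb hc :=
    e.injective (h.uniq _ _ _ _ h5 (e.map_adj_iff.2 hab) (e.map_adj_iff.2 hac) hb hc)
  six := by
    obtain ⟨u, v, huv⟩ := h.six
    exact ⟨e.symm u, e.symm v, by simpa using huv⟩

section
variable {V : Type} {G : SimpleGraph V} {f : V → V → ℕ}

theorem Cert.exists_walk (h : Cert G f) (u : V) : ∀ (n : ℕ) (a : V), f u a = n →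
    ∃ w : G.Walk a u, w.length = n
  | 0, a, ha => by
    obtain rfl := h.eq_of_zero _ _ ha
    exact ⟨.nil, rfl⟩
  | n + 1, a, ha => by
    obtain ⟨b, hab, hb⟩ := h.down u a (by omega)
    obtain ⟨w, hw⟩ := h.exists_walk u n b (by omega)
    exact ⟨.cons hab w, by simp [hw]⟩

theorem Cert.le_length (h : Cert G f) (u : V) {a b : V} (w : G.Walk a b) :
    f u b ≤ f u a + w.length := by
  induction w with
  | nil => simp
  | cons hab p ih =>
    have := h.adj u _ _ hab
    simp only [SimpleGraph.Walk.length_cons]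
    omega

theorem Cert.connected (h : Cert G f) : G.Connected := by
  obtain ⟨u, _, _⟩ := h.six
  have : Nonempty V := ⟨u⟩
  refine ⟨fun a b => ?_⟩
  obtain ⟨w, _⟩ := h.exists_walk b _ a rfl
  exact ⟨w⟩

theorem Cert.diam (h : Cert G f) : G.diam = 6 := by
  have hle : G.ediam ≤ 6 := by
    refine SimpleGraph.ediam_le_of_edist_le fun a b => ?_
    obtain ⟨w, hw⟩ := h.exists_walk b _ a rfl
    refine (SimpleGraph.Walk.edist_le w).trans ?_
    rw [hw]
    exact_mod_cast h.le_six b a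
  have hge : (6 : ℕ∞) ≤ G.ediam := by
    obtain ⟨u, v, huv⟩ := h.six
    refine le_trans ?_ (SimpleGraph.edist_le_ediam (u := u) (v := v))
    obtain ⟨w, hw⟩ := (h.connected u v).exists_walk_length_eq_edist
    rw [← hw]
    have := h.le_length u w
    rw [h.self, huv] at this
    exact_mod_cast (by omega : 6 ≤ w.length)
  rw [SimpleGraph.diam, le_antisymm hle hge]
  rfl

theorem Cert.le_cycle (h : Cert G f) (u : V) (w : G.Walk u u) (hw : w.IsCycle) :
    12 ≤ w.length := by
  by_contra hlt
  have h3 := hw.three_le_length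
  have key : ∀ i, i ≤ 6 → i ≤ w.length → f u (w.getVert i) = i := by
    intro i
    induction i using Nat.strong_induction_on with
    | _ i ih =>
      intro h6 hl
      match i with
      | 0 => simpa using h.self u
      | 1 =>
        have := h.adj u _ _ (w.adj_getVert_succ (i := 0) (by omega))
        have h0 := h.self u
        simp only [SimpleGraph.Walk.getVert_zero, zero_add] at this
        omega
      | j + 2 =>
        have h1 := ih (j + 1) (by omega) (by omega) (by omega)
        have h0 := ih j (by omega) (by omega) (by omega)
        have ha := w.adj_getVert_succ (i := j) (by omega)
        have hb := w.adj_getVert_succ (i := j + 1) (by omega)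
        have hne := hw.getVert_sub_one_ne_getVert_add_one (i := j + 1) (by omega)
        rcases h.adj u _ _ hb with h2 | h2
        · rw [h2, h1]
        · exact absurd (h.uniq u _ _ _ (by omega) ha.symm hb (by omega) (by omega)) hne
  by_cases hn : w.length ≤ 6
  · have := key w.length hn le_rfl
    rw [SimpleGraph.Walk.getVert_length, h.self] at this
    omega
  · have h6 := key 6 le_rfl (by omega)
    have := h.le_length u (w.drop 6).reverse
    rw [h.self, h6] at this
    simp at this
    omega

theorem Cert.girth (h : Cert G f) (u : V) (w : G.Walk u u) (hw : w.IsCycle)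
    (hl : w.length = 12) : G.girth = 12 := by
  have hle : G.egirth ≤ 12 := by
    have := SimpleGraph.egirth_le_length hw
    rwa [hl] at this
  have hge : (12 : ℕ∞) ≤ G.egirth := by
    rw [SimpleGraph.le_egirth]
    intro a w hw
    exact_mod_cast h.le_cycle a w hw
  rw [SimpleGraph.girth, le_antisymm hle hge]
  rfl

end

/-- The LCF code, entries modulo `126`, in base `128`. -/
def code : ℕ := 72752103561625541839601673028230729105

/-- The chord of the LCF description at `v`. -/
def chord (v : ℕ) : ℕ := (v + (code >>> (7 * (v % 18))) % 128) % 126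

/-- The distances from the first `18` vertices, in base `8`. -/
def table : ℕ :=
  4942785418783913295066746001704418905751891800215070983257633372097646507166129054058286383364985483848745611270968839394093284088352665712225179946060058387401296085169425151160825076346606711534795539016055985674988406112158036786993569909502391208412649814208156647890664130871194739558642885567634606017527252139642942933200460575989650960898078302969641280512101874581032549786632610902181928344865248333285444808747160120892465795070639888216315992563800398907314780923455910671800096846699462431349732372823928478359526537982338125969949123556358093319809028639067381449349902893355241965795784942345307116334297613543483470476455940547266050728526008843833145248363295224828759077668390433190089760388793330128023646431392686537956119905232784080696294626267388909681531827783521645345951619047520485629706968482151281059765059870604241963791250989564054810862321366728835969442766519056628213353048635817745917670590227293759601560661737017461190555463205709079933899426038645296316875040565749454647934469754993333381982582656872548035006533079802593972544204335058559548178757281695844413108613590884402043328887672849982090394580912794421747145368791026123176657834302176082319048431606237254353629859103386279527076164119315712765029246749980598652099781149952850683306143224348627940718088485631197337132866982214827299617016943636718278782456355252699524726818598088700692715463449823363314384815402783568616488975715258472790710642019385013156749156049845126332071635563909320735698131709554915273248571438599125175031440252803912404188796691090350217886113384844805020439456826657849585795287678229267323489916916745038386586974166369012717691687281532756036188570086977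7143102653570645018113991751195604958791520044818776627069763842779698654346286486231379686819651970797094548798126033196490449279281765635140159401468616877732816461342124272610117060148430726145264784403522214328620872518796723690068677953946401588410449553898265095439267115335454313711353300609028169770523918465778068742634286642589566194608521392030402184

/-- The distance function. -/
def dst (u v : ℕ) : ℕ := (table >>> (3 * (u % 18 * 126 + (v + 126 - u + u % 18) % 126))) % 8

/-- Adjacency, as a Boolean. -/
def adjB (a b : ℕ) : Bool := b == (a + 1) % 126 || b == (a + 125) % 126 || b == chord a

/-- The Tutte 12-cage. -/
def H : SimpleGraph (Fin 126) where
  Adj a b := adjB a b = true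
  symm := ⟨by decide +kernel⟩
  loopless := ⟨by decide +kernel⟩

instance : DecidableRel H.Adj := fun a b => inferInstanceAs (Decidable (adjB a b = true))

/-- Local conditions on the distances `x` of a vertex and `p q r` of its neighbours. -/
def chk (x p q r : ℕ) : Bool :=
  bif x == 0 then p == 1 && q == 1 && r == 1 else
  bif x == 6 then p == 5 && q == 5 && r == 5 else
    x.blt 6 &&
    (p + 1 == x && q == x + 1 && r == x + 1 ||
      q + 1 == x && p == x + 1 && r == x + 1 ||
      r + 1 == x && p == x + 1 && q == x + 1)

theorem chk_all : ∀ u < 126, ∀ v < 126,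
    chk (dst u v) (dst u ((v + 1) % 126)) (dst u ((v + 125) % 126)) (dst u (chord v)) = true := by
  decide +kernel

theorem zero_all : ∀ u < 126, ∀ v < 126, (dst u v == 0) = (u == v) := by
  decide +kernel

theorem chk_spec {x p q r : ℕ} (h : chk x p q r = true) :
    (x = 0 ∧ p = 1 ∧ q = 1 ∧ r = 1) ∨ (x = 6 ∧ p = 5 ∧ q = 5 ∧ r = 5) ∨
    (x ≠ 0 ∧ x < 6 ∧ ((p + 1 = x ∧ q = x + 1 ∧ r = x + 1) ∨ (q + 1 = x ∧ p = x + 1 ∧ r = x + 1) ∨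
      (r + 1 = x ∧ p = x + 1 ∧ q = x + 1))) := by
  unfold chk at h
  by_cases h0 : x = 0
  · simp [h0] at h; omega
  · by_cases h6 : x = 6
    · simp [h6] at h; omega
    · have e0 : (x == 0) = false := by simpa using h0
      have e6 : (x == 6) = false := by simpa using h6
      simp only [e0, e6, cond_false, Bool.and_eq_true, Bool.or_eq_true, beq_iff_eq,
        Nat.blt_eq] at h
      refine Or.inr (Or.inr ⟨h0, h.1, ?_⟩)
      rcases h.2 with (⟨⟨h1, h2⟩, h3⟩ | ⟨⟨h1, h2⟩, h3⟩) | ⟨⟨h1, h2⟩, h3⟩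
      · exact Or.inl ⟨h1, h2, h3⟩
      · exact Or.inr (Or.inl ⟨h1, h2, h3⟩)
      · exact Or.inr (Or.inr ⟨h1, h2, h3⟩)

theorem chord_lt (v : ℕ) : chord v < 126 := Nat.mod_lt _ (by norm_num)

theorem adj_cases {a b : Fin 126} (h : H.Adj a b) :
    b.val = (a.val + 1) % 126 ∨ b.val = (a.val + 125) % 126 ∨ b.val = chord a := by
  have h' : adjB a b = true := h
  simpa [adjB, or_assoc] using h'

theorem cert : Cert H (fun a b => dst a b) where
  self u := by
    have := zero_all u u.2 u u.2
    simpa using this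
  eq_of_zero u v h := by
    have := zero_all u u.2 v v.2
    simp only [h] at this
    apply Fin.ext
    simpa using this.symm
  le_six u v := by
    have := chk_spec (chk_all u u.2 v v.2)
    omega
  adj u a b hab := by
    have := chk_spec (chk_all u u.2 a a.2)
    rcases adj_cases hab with h | h | h <;> simp only [h] <;> omega
  down u a ha := by
    have := chk_spec (chk_all u u.2 a a.2)
    have hx : dst u ((a + 1) % 126) + 1 = dst u a ∨ dst u ((a + 125) % 126) + 1 = dst u a ∨
        dst u (chord a) + 1 = dst u a := by omega
    rcases hx with hx | hx | hx
    · exact ⟨⟨(a + 1) % 126, Nat.mod_lt _ (by norm_num)⟩, by simp [H, adjB], hx⟩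
    · exact ⟨⟨(a + 125) % 126, Nat.mod_lt _ (by norm_num)⟩, by simp [H, adjB], hx⟩
    · exact ⟨⟨chord a, chord_lt a⟩, by simp [H, adjB], hx⟩
  uniq u a b c h5 hab hac hb hc := by
    have := chk_spec (chk_all u u.2 a a.2)
    apply Fin.ext
    rcases adj_cases hab with h | h | h <;> rcases adj_cases hac with h' | h' | h' <;>
      simp only [h, h'] at hb hc ⊢ <;> omega
  six := by decide +kernel

/-- A cycle of length 12. -/
def cyc : H.Walk 0 0 :=
  .cons (v := 17) (by decide +kernel) <| .cons (v := 18) (by decide +kernel) <|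
  .cons (v := 19) (by decide +kernel) <| .cons (v := 20) (by decide +kernel) <|
  .cons (v := 7) (by decide +kernel) <| .cons (v := 6) (by decide +kernel) <|
  .cons (v := 5) (by decide +kernel) <| .cons (v := 4) (by decide +kernel) <|
  .cons (v := 3) (by decide +kernel) <| .cons (v := 2) (by decide +kernel) <|
  .cons (v := 1) (by decide +kernel) <| .cons (v := 0) (by decide +kernel) .nil

theorem cyc_isCycle : cyc.IsCycle := by
  rw [SimpleGraph.Walk.isCycle_def, SimpleGraph.Walk.isTrail_def]
  refine ⟨?_, ?_, ?_⟩
  · simp only [cyc, SimpleGraph.Walk.edges_cons, SimpleGraph.Walk.edges_nil]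
    decide +kernel
  · simp [cyc]
  · simp only [cyc, SimpleGraph.Walk.support_cons, SimpleGraph.Walk.support_nil]
    decide +kernel

/-- The points of the `j`-th line. -/
def line (j : Fin 63) : Finset (Fin 63) :=
  {j, j + 1, ⟨chord (2 * j + 1) / 2, by have := chord_lt (2 * j + 1); omega⟩}

theorem line_injective : Function.Injective line := by
  have : ∀ i j, line i = line j → i = j := by decide +kernel
  exact fun i j => this i j

/-- Points are the even vertices and lines are the odd vertices. -/
def toFin : Fin 63 ⊕ Fin 63 → Fin 126
  | .inl p => ⟨2 * p, by omega⟩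
  | .inr j => ⟨2 * j + 1, by omega⟩

theorem toFin_bijective : Function.Bijective toFin := by
  refine (Fintype.bijective_iff_injective_and_card _).2 ⟨?_, by simp⟩
  rintro (a | a) (b | b) h <;> simp only [toFin, Fin.mk.injEq] at h <;>
    first | omega | (congr 1; omega)

theorem adj_iff : ∀ p j : Fin 63, H.Adj (toFin (.inl p)) (toFin (.inr j)) ↔ p ∈ line j := by
  decide +kernel

theorem not_adj_even : ∀ p q : Fin 63, ¬ H.Adj (toFin (.inl p)) (toFin (.inl q)) := by
  decide +kernel

theorem not_adj_odd : ∀ p q : Fin 63, ¬ H.Adj (toFin (.inr p)) (toFin (.inr q)) := by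
  decide +kernel

/-- The set of lines. -/
def lines : Finset (Finset (Fin 63)) := Finset.univ.image line

/-- Lines are indexed by `Fin 63`. -/
noncomputable def lineEquiv : Fin 63 ≃ {l // l ∈ lines} :=
  Equiv.ofBijective (fun j => ⟨line j, Finset.mem_image_of_mem _ (Finset.mem_univ j)⟩)
    ⟨fun i j h => line_injective (congrArg Subtype.val h), fun ⟨l, hl⟩ => by
      obtain ⟨j, _, rfl⟩ := Finset.mem_image.1 hl
      exact ⟨j, rfl⟩⟩

/-- The incidence graph. -/
def inc : SimpleGraph (Fin 63 ⊕ {l // l ∈ lines}) :=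
  SimpleGraph.fromRel fun a b =>
    ∃ (p : Fin 63) (l : {l // l ∈ lines}), a = Sum.inl p ∧ b = Sum.inr l ∧ p ∈ l.val

/-- The incidence graph is the Tutte 12-cage. -/
noncomputable def isoH : H ≃g inc where
  toEquiv := (Equiv.ofBijective _ toFin_bijective).symm.trans
    ((Equiv.refl _).sumCongr lineEquiv)
  map_rel_iff' := by
    intro a b
    obtain ⟨a, rfl⟩ := toFin_bijective.2 a
    obtain ⟨b, rfl⟩ := toFin_bijective.2 b
    have hs : ∀ x, (Equiv.ofBijective _ toFin_bijective).symm (toFin x) = x :=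
      fun x => (Equiv.ofBijective _ toFin_bijective).symm_apply_apply x
    have hl : ∀ j, (lineEquiv j).val = line j := fun _ => rfl
    rcases a with p | p <;> rcases b with q | q
    · simp [hs, inc, not_adj_even]
    · simp [hs, inc, adj_iff, hl]
    · rw [H.adj_comm]
      simp [hs, inc, adj_iff, hl]
    · simp [hs, inc, not_adj_odd]

theorem filter_card (s : Finset (Fin 63) → Prop) [DecidablePred s] :
    (lines.filter s).card = (Finset.univ.filter fun j => s (line j)).card := by
  rw [lines, Finset.filter_image, Finset.card_image_of_injective _ line_injective]

theorem line_card : ∀ j, (line j).card = 3 := by decide +kernel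

theorem point_card : ∀ p, (Finset.univ.filter fun j => p ∈ line j).card = 3 := by
  decide +kernel

/-- Two lines through two common points are equal: otherwise they form a 4-cycle; checked
directly. -/
theorem pair_lines : ∀ i j, i ≠ j → (line i ∩ line j).card ≤ 1 := by
  decide +kernel

end Hexagon

open Hexagon in
/-- There exists a generalized hexagon of order `(2,2)`: a point set `P` of `63` points
and a collection `L` of `63` lines, each line a 3-element subset of `P`, such that every
point lies in exactly `3` lines, two distinct points lie in at most one common line, and
the bipartite point-line incidence graph is connected with diameter `6` and girth `12`. -/
theorem exists_generalized_hexagon_of_order_two_two :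
    ∃ (P : Type) (_ : Fintype P) (_ : DecidableEq P) (L : Finset (Finset P)),
      Nat.card P = 63 ∧
      L.card = 63 ∧
      (∀ l ∈ L, l.card = 3) ∧
      (∀ p : P, (L.filter fun l => p ∈ l).card = 3) ∧
      (∀ p q : P, p ≠ q → (L.filter fun l => p ∈ l ∧ q ∈ l).card ≤ 1) ∧
      (let G : SimpleGraph (P ⊕ {l // l ∈ L}) :=
        SimpleGraph.fromRel fun a b =>
          ∃ (p : P) (l : {l // l ∈ L}), a = Sum.inl p ∧ b = Sum.inr l ∧ p ∈ l.val
      G.Connected ∧ G.diam = 6 ∧ G.girth = 12) := by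
  refine ⟨Fin 63, inferInstance, inferInstance, lines, by simp, ?_, ?_, ?_, ?_, ?_⟩
  · rw [lines, Finset.card_image_of_injective _ line_injective]
    simp
  · intro l hl
    obtain ⟨j, _, rfl⟩ := Finset.mem_image.1 hl
    exact line_card j
  · intro p
    rw [filter_card]
    exact point_card p
  · intro p q hpq
    rw [filter_card, Finset.card_le_one]
    intro i hi j hj
    by_contra hij
    simp only [Finset.mem_filter, Finset.mem_univ, true_and] at hi hj
    exact hpq (Finset.card_le_one.1 (pair_lines i j hij) p (Finset.mem_inter.2 ⟨hi.1, hj.1⟩) q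
      (Finset.mem_inter.2 ⟨hi.2, hj.2⟩))
  · have c := cert.comap isoH.symm
    exact ⟨c.connected, c.diam, isoH.girth_eq.symm.trans (cert.girth 0 cyc cyc_isCycle rfl)⟩
end
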